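/- Let e, v, e', v' ∈ ℝ^d be spacelike vectors of Minkowski space 𝕄^{1,d-1} with η(e,v) = 0 and η(e',v') = 0, and define the endomorphisms G(w) = η(v,w)·e - η(e,w)·v and G'(w) = η(v',w)·e' - η(e',w)·v'. Assume G and G' are linearly independent as endomorphisms. Then G∘G' = G'∘G if and only if the four vectors e, v, e', v' are mutually η-orthogonal, i.e. η(e,e') = η(e,v') = η(v,e') = η(v,v') = 0. -/

import Mathlib

open scoped BigOperators

/-- The Minkowski bilinear form on `ℝ^d`. -/
noncomputable def mink (d : ℕ) (x y : Fin d → ℝ) : ℝ :=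
  ∑ i : Fin d, (if (i : ℕ) = 0 then (-1 : ℝ) else 1) * x i * y i

theorem mink_comm (d : ℕ) (x y : Fin d → ℝ) : mink d x y = mink d y x :=
  Finset.sum_congr rfl fun _ _ => by ring

theorem mink_smul_right (d : ℕ) (c : ℝ) (x y : Fin d → ℝ) :
    mink d x (c • y) = c * mink d x y := by
  simp only [mink, Finset.mul_sum, Pi.smul_apply, smul_eq_mul]
  exact Finset.sum_congr rfl fun _ _ => by ring

theorem mink_sub_right (d : ℕ) (x y z : Fin d → ℝ) :
    mink d x (y - z) = mink d x y - mink d x z := by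
  simp only [mink, ← Finset.sum_sub_distrib, Pi.sub_apply]
  exact Finset.sum_congr rfl fun _ _ => by ring

/-- A spacelike vector and an orthogonal spacelike vector admit no nontrivial relation. -/
theorem eq_zero_of_smul_sub_smul_eq_zero (d : ℕ) {x y : Fin d → ℝ} (hx : 0 < mink d x x)
    (hy : 0 < mink d y y) (hxy : mink d x y = 0) {a b : ℝ} (h : a • x - b • y = 0) :
    a = 0 ∧ b = 0 := by
  have key (z : Fin d → ℝ) : a * mink d z x - b * mink d z y = 0 := by
    rw [← mink_smul_right, ← mink_smul_right, ← mink_sub_right, h]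
    simp [mink]
  have h₁ := key x
  have h₂ := key y
  rw [hxy] at h₁
  rw [mink_comm d y x, hxy] at h₂
  simp only [mul_zero, sub_zero, zero_sub, neg_eq_zero, mul_eq_zero] at h₁ h₂
  exact ⟨h₁.resolve_right hx.ne', h₂.resolve_right hy.ne'⟩

/-- Two linearly independent simple spacelike skew-symmetric endomorphisms
`G, G'` built from orthogonal spacelike pairs `(e,v)` and `(e',v')` commute
iff the four vectors are mutually orthogonal. -/
theorem stmt16 (d : ℕ)
    (e v e' v' : Fin d → ℝ)
    (he : 0 < mink d e e) (hv : 0 < mink d v v)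
    (he' : 0 < mink d e' e') (hv' : 0 < mink d v' v')
    (hev : mink d e v = 0) (hev' : mink d e' v' = 0)
    (G G' : (Fin d → ℝ) →ₗ[ℝ] (Fin d → ℝ))
    (hG : ∀ w : Fin d → ℝ, G w = mink d v w • e - mink d e w • v)
    (hG' : ∀ w : Fin d → ℝ, G' w = mink d v' w • e' - mink d e' w • v')
    (hind : LinearIndependent ℝ ![G, G']) :
    G ∘ₗ G' = G' ∘ₗ G ↔
      (mink d e e' = 0 ∧ mink d e v' = 0 ∧ mink d v e' = 0 ∧ mink d v v' = 0) := by
  have hve : mink d v e = 0 := by rw [mink_comm, hev]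
  constructor
  · intro hcomm
    have hc (w : Fin d → ℝ) : G (G' w) = G' (G w) := LinearMap.congr_fun hcomm w
    set D := mink d e v' * mink d v e' - mink d e e' * mink d v v' with hD
    have h₁ : D • e = (-mink d e e) • (mink d v v' • e' - mink d v e' • v') := by
      have h := hc e
      rw [hG e, hve, zero_smul, zero_sub, map_neg, map_smul, hG' v, hG, hG' e] at h
      simp only [mink_sub_right, mink_smul_right, mink_comm d v' e, mink_comm d e' e,
        mink_comm d v' v, mink_comm d e' v] at h
      rw [neg_smul, ← h, hD]
      module
    have h₂ : D • v = mink d v v • (mink d e v' • e' - mink d e e' • v') := by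
      have h := hc v
      rw [hG v, hev, zero_smul, sub_zero, map_smul, hG' e, hG, hG' v] at h
      simp only [mink_sub_right, mink_smul_right, mink_comm d v' e, mink_comm d e' e,
        mink_comm d v' v, mink_comm d e' v] at h
      rw [← h, hD]
      module
    have hrel : (D * D) • G + (mink d e e * mink d v v * D) • G' = 0 := by
      refine LinearMap.ext fun w => ?_
      have h : (D * D) • G w = mink d w (D • v) • (D • e) - mink d w (D • e) • (D • v) := by
        rw [hG, mink_smul_right, mink_smul_right, mink_comm d v, mink_comm d e]
        module
      rw [LinearMap.add_apply, LinearMap.smul_apply, LinearMap.smul_apply, h, h₁, h₂, hG']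
      simp only [mink_sub_right, mink_smul_right, mink_comm d v' w, mink_comm d e' w,
        LinearMap.zero_apply, hD]
      module
    have hD₀ : D = 0 := mul_self_eq_zero.mp (LinearIndependent.pair_iff.mp hind _ _ hrel).1
    rw [hD₀, zero_smul] at h₁ h₂
    obtain ⟨h₃, h₄⟩ := eq_zero_of_smul_sub_smul_eq_zero d he' hv' hev'
      ((smul_eq_zero.mp h₁.symm).resolve_left (neg_ne_zero.mpr he.ne'))
    obtain ⟨h₅, h₆⟩ := eq_zero_of_smul_sub_smul_eq_zero d he' hv' hev'
      ((smul_eq_zero.mp h₂.symm).resolve_left hv.ne')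
    exact ⟨h₆, h₅, h₄, h₃⟩
  · rintro ⟨h₁, h₂, h₃, h₄⟩
    refine LinearMap.ext fun w => ?_
    simp only [LinearMap.comp_apply, hG, hG', mink_sub_right, mink_smul_right,
      mink_comm d v' e, mink_comm d e' e, mink_comm d v' v, mink_comm d e' v, h₁, h₂, h₃, h₄]
    simp
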